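/- arXiv:1204.1848 — 2 statements merged into one kernel-verified Lean document; each statement's English description precedes it below -/
import Mathlib

section
/- For all real numbers λ1, λ, λ2 with 0 < λ1 < λ < λ2, there exist real numbers a and b with 0 ≤ a < b such that exp(-λ·a) - exp(-λ·b) > exp(-λ1·a) - exp(-λ1·b) and exp(-λ·a) - exp(-λ·b) > exp(-λ2·a) - exp(-λ2·b). -/
/-- The exponential density `x * exp (-x * t)`, seen as a function of the rate `x`, is strictly
maximal at `x = t⁻¹`. -/
theorem mul_exp_neg_mul_inv_lt {l x : ℝ} (hl : 0 < l) (hx : x ≠ l) :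
    x * Real.exp (-x * l⁻¹) < l * Real.exp (-l * l⁻¹) := by
  have hne : x / l - 1 ≠ 0 := by
    rw [sub_ne_zero, Ne, div_eq_one_iff_eq hl.ne']
    exact hx
  have h := Real.add_one_lt_exp hne
  rw [sub_add_cancel, div_lt_iff₀ hl] at h
  calc x * Real.exp (-x * l⁻¹)
      < Real.exp (x / l - 1) * l * Real.exp (-x * l⁻¹) :=
        mul_lt_mul_of_pos_right h (Real.exp_pos _)
    _ = l * (Real.exp (x / l - 1) * Real.exp (-x * l⁻¹)) := by ring
    _ = l * Real.exp (-l * l⁻¹) := by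
        rw [← Real.exp_add]
        congr 2
        field_simp
        ring

theorem HasDerivAt.eventually_nhdsGT_lt {f : ℝ → ℝ} {f' t : ℝ} (hf : HasDerivAt f f' t)
    (hpos : 0 < f') : ∀ᶠ b in nhdsWithin t (Set.Ioi t), f t < f b := by
  have hslope := (hf.tendsto_slope.mono_left
    (nhdsWithin_mono t fun _ hb => ne_of_gt hb)).eventually (lt_mem_nhds hpos)
  filter_upwards [hslope, self_mem_nhdsWithin] with b hb htb
  rw [slope_def_field, div_pos_iff_of_pos_right (sub_pos.2 htb)] at hb
  exact sub_pos.1 hb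

theorem hasDerivAt_exp_neg_mul (x t : ℝ) :
    HasDerivAt (fun s => Real.exp (-x * s)) (-(x * Real.exp (-x * t))) t := by
  have h := ((hasDerivAt_id' t).const_mul (-x)).exp
  convert h using 1
  ring

/-- On a short interval starting at `l⁻¹`, rate `l` gives more mass than any other fixed rate. -/
theorem eventually_exp_sub_exp_lt {l x : ℝ} (hl : 0 < l) (hx : x ≠ l) :
    ∀ᶠ b in nhdsWithin l⁻¹ (Set.Ioi l⁻¹),
      Real.exp (-x * l⁻¹) - Real.exp (-x * b) < Real.exp (-l * l⁻¹) - Real.exp (-l * b) := by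
  have hderiv := (hasDerivAt_exp_neg_mul x l⁻¹).sub (hasDerivAt_exp_neg_mul l l⁻¹)
  have hlt := mul_exp_neg_mul_inv_lt hl hx
  filter_upwards [hderiv.eventually_nhdsGT_lt (by linarith)] with b hb
  simp only [Pi.sub_apply] at hb
  linarith

theorem stmt2 (l1 l l2 : ℝ) (h1 : 0 < l1) (h2 : l1 < l) (h3 : l < l2) :
    ∃ a b : ℝ, 0 ≤ a ∧ a < b ∧
      Real.exp (-l * a) - Real.exp (-l * b) > Real.exp (-l1 * a) - Real.exp (-l1 * b) ∧
      Real.exp (-l * a) - Real.exp (-l * b) > Real.exp (-l2 * a) - Real.exp (-l2 * b) := by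
  have hl : 0 < l := h1.trans h2
  obtain ⟨b, ⟨hb1, hb2⟩, hab⟩ := (((eventually_exp_sub_exp_lt hl h2.ne).and
    (eventually_exp_sub_exp_lt hl h3.ne')).and self_mem_nhdsWithin).exists
  exact ⟨l⁻¹, b, (inv_pos.2 hl).le, hab, hb1, hb2⟩
end

section
/- Let λ1, λ2, a, b be real numbers with 0 < λ2 < λ1 and 0 ≤ a < b. Then (exp(-λ2·a) - exp(-λ2·b)) / (exp(-λ1·a) - exp(-λ1·b)) > λ2/λ1; equivalently, λ1·(exp(-λ2·a) - exp(-λ2·b)) > λ2·(exp(-λ1·a) - exp(-λ1·b)). -/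
theorem strictMonoOn_mul_exp_sub_mul_exp {l1 l2 : ℝ} (h1 : 0 < l2) (h2 : l2 < l1) :
    StrictMonoOn (fun t : ℝ => l2 * Real.exp (-l1 * t) - l1 * Real.exp (-l2 * t))
      (Set.Ici 0) := by
  refine strictMonoOn_of_deriv_pos (convex_Ici 0) (by fun_prop) fun t ht => ?_
  rw [interior_Ici, Set.mem_Ioi] at ht
  have hexp (l : ℝ) : HasDerivAt (fun t : ℝ => Real.exp (-l * t)) (Real.exp (-l * t) * -l) t := by
    simpa using ((hasDerivAt_id t).const_mul (-l)).exp
  rw [(((hexp l1).const_mul l2).fun_sub ((hexp l2).const_mul l1)).deriv]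
  have hlt : Real.exp (-l1 * t) < Real.exp (-l2 * t) := Real.exp_lt_exp.mpr (by nlinarith)
  have hpos := mul_pos (mul_pos h1 (h1.trans h2)) (sub_pos.mpr hlt)
  linarith

theorem stmt16 (l1 l2 a b : ℝ) (h1 : 0 < l2) (h2 : l2 < l1) (ha : 0 ≤ a) (hab : a < b) :
    (Real.exp (-l2 * a) - Real.exp (-l2 * b)) / (Real.exp (-l1 * a) - Real.exp (-l1 * b))
      > l2 / l1 ∧
    l1 * (Real.exp (-l2 * a) - Real.exp (-l2 * b))
      > l2 * (Real.exp (-l1 * a) - Real.exp (-l1 * b)) := by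
  have hl1 : 0 < l1 := h1.trans h2
  have hmono := strictMonoOn_mul_exp_sub_mul_exp h1 h2 ha (ha.trans hab.le) hab
  have hmul : l2 * (Real.exp (-l1 * a) - Real.exp (-l1 * b))
      < l1 * (Real.exp (-l2 * a) - Real.exp (-l2 * b)) := by
    linarith
  have hden : 0 < Real.exp (-l1 * a) - Real.exp (-l1 * b) :=
    sub_pos.mpr (Real.exp_lt_exp.mpr (by nlinarith))
  refine ⟨?_, hmul⟩
  rw [gt_iff_lt, div_lt_div_iff₀ hl1 hden]
  linarith
end
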